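/- arXiv:1010.3337 — 10 statements merged into one kernel-verified Lean document; each statement's English description precedes it below -/
import Mathlib

section
/- Let N ≥ 1 and let a : Fin N → ℝ satisfy a i > 0 for all i, and let T > 0. Then there exists a unique λ > 0 such that ∑_{i} max(0, 1/λ − 1/(a i)) = T. -/
theorem wl_strict (N : ℕ) (a : Fin N → ℝ) (x y : ℝ) (hxy : x < y)
    (h : 0 < ∑ i, max 0 (y - 1 / a i)) :
    ∑ i, max 0 (x - 1 / a i) < ∑ i, max 0 (y - 1 / a i) := by
  obtain ⟨j, hj, hpos⟩ := Finset.exists_lt_of_sum_lt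
    (s := Finset.univ) (f := fun _ : Fin N => (0 : ℝ)) (g := fun i => max 0 (y - 1 / a i))
    (by simpa using h)
  have hj2 : 0 < y - 1 / a j := by
    rcases lt_max_iff.mp hpos with h | h
    · exact absurd h (lt_irrefl _)
    · exact h
  apply Finset.sum_lt_sum
  · intro i _
    exact max_le_max le_rfl (by linarith)
  · exact ⟨j, hj, lt_of_lt_of_le (max_lt hj2 (by linarith)) (le_max_right _ _)⟩

/-- Existence and uniqueness of the water level: for aptitudes `a i > 0` and total
time `T > 0`, there is a unique `λ > 0` such that the water-filling times
`max 0 (1/λ - 1/(a i))` sum to `T`. -/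
theorem water_level_exists_unique (N : ℕ) (hN : 1 ≤ N) (a : Fin N → ℝ)
    (ha : ∀ i, 0 < a i) (T : ℝ) (hT : 0 < T) :
    ∃! lam : ℝ, 0 < lam ∧ ∑ i, max 0 (1 / lam - 1 / a i) = T := by
  have hc : Continuous (fun x : ℝ => ∑ i, max 0 (x - 1 / a i)) := by fun_prop
  have h0 : ∑ i, max 0 ((0 : ℝ) - 1 / a i) = 0 := by
    apply Finset.sum_eq_zero
    intro i _
    have := one_div_pos.mpr (ha i)
    exact max_eq_left (by linarith)
  let j : Fin N := ⟨0, hN⟩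
  have hj := one_div_pos.mpr (ha j)
  have h1 : T ≤ ∑ i, max 0 ((T + 1 / a j) - 1 / a i) := by
    calc T ≤ max 0 ((T + 1 / a j) - 1 / a j) := le_max_of_le_right (by linarith)
      _ ≤ _ := Finset.single_le_sum (f := fun i => max 0 ((T + 1 / a j) - 1 / a i))
        (fun i _ => le_max_left _ _) (Finset.mem_univ j)
  obtain ⟨x, hx, hxT⟩ := intermediate_value_Icc (by linarith : (0 : ℝ) ≤ T + 1 / a j)
    hc.continuousOn ⟨h0.le.trans hT.le, h1⟩
  simp only at hxT
  have hx0 : 0 < x := by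
    rcases hx.1.lt_or_eq with h | h
    · exact h
    · rw [← h, h0] at hxT
      exact absurd hxT hT.ne
  refine ⟨1 / x, ⟨one_div_pos.mpr hx0, by rw [one_div_one_div]; exact hxT⟩, ?_⟩
  rintro l ⟨hl, hlT⟩
  have : 1 / l = x := by
    rcases lt_trichotomy (1 / l) x with h | h | h
    · have := wl_strict N a _ _ h (by rw [hxT]; exact hT)
      linarith
    · exact h
    · have := wl_strict N a _ _ h (by rw [hlT]; exact hT)
      linarith
  rw [← this, one_div_one_div]
end

section
/- Let N ≥ 1, a : Fin N → ℝ with a i > 0 for all i, T > 0, and let λ > 0 satisfy ∑_{i} max(0, 1/λ − 1/(a i)) = T. Define t i = max(0, 1/λ − 1/(a i)). Then t is a feasible allocation (t i ≥ 0 for all i and ∑ t i = T), and for every allocation s (s i ≥ 0 for all i, ∑ s i = T) one has ∑_{i} log(1 + a i * s i) ≤ ∑_{i} log(1 + a i * t i). -/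
theorem waterfilling_key (a lam s : ℝ) (ha : 0 < a) (hlam : 0 < lam) (hs : 0 ≤ s) :
    Real.log (1 + a * s) ≤ Real.log (1 + a * max 0 (1 / lam - 1 / a)) +
      lam * (s - max 0 (1 / lam - 1 / a)) := by
  have hp : 0 < 1 + a * s := by positivity
  rcases le_total a lam with h | h
  · have h1 : 1 / lam - 1 / a ≤ 0 := sub_nonpos.mpr (one_div_le_one_div_of_le ha h)
    rw [max_eq_left h1]
    have := Real.log_le_sub_one_of_pos hp
    have h2 := mul_le_mul_of_nonneg_right h hs
    simp
    linarith
  · have h1 : 0 ≤ 1 / lam - 1 / a := sub_nonneg.mpr (one_div_le_one_div_of_le hlam h)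
    rw [max_eq_right h1]
    have e : 1 + a * (1 / lam - 1 / a) = a / lam := by field_simp; ring
    have hq : 0 < a / lam := by positivity
    have h3 := Real.log_le_sub_one_of_pos (div_pos hp hq)
    rw [Real.log_div hp.ne' hq.ne'] at h3
    have e2 : (1 + a * s) / (a / lam) - 1 = lam * (s - (1 / lam - 1 / a)) := by
      field_simp; ring
    rw [e]
    linarith

/-- The water-filling allocation `t i = max 0 (1/λ - 1/(a i))` (with `λ > 0` chosen so
that the times sum to `T`) is feasible and maximizes `∑ log (1 + a i * s i)` over all
feasible allocations `s`. -/
theorem waterfilling_is_optimal (N : ℕ) (hN : 1 ≤ N) (a : Fin N → ℝ)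
    (ha : ∀ i, 0 < a i) (T : ℝ) (hT : 0 < T) (lam : ℝ) (hlam : 0 < lam)
    (hsum : ∑ i, max 0 (1 / lam - 1 / a i) = T) :
    (∀ i, 0 ≤ max 0 (1 / lam - 1 / a i)) ∧
    (∑ i, max 0 (1 / lam - 1 / a i) = T) ∧
    (∀ s : Fin N → ℝ, (∀ i, 0 ≤ s i) → ∑ i, s i = T →
      ∑ i, Real.log (1 + a i * s i) ≤
        ∑ i, Real.log (1 + a i * max 0 (1 / lam - 1 / a i))) := by
  refine ⟨fun i => le_max_left _ _, hsum, fun s hs hsT => ?_⟩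
  have key := Finset.sum_le_sum (fun i (_ : i ∈ Finset.univ) =>
    waterfilling_key (a i) lam (s i) (ha i) hlam (hs i))
  rw [Finset.sum_add_distrib, ← Finset.mul_sum, Finset.sum_sub_distrib, hsum, hsT] at key
  simpa using key
end

section
/- Let N ≥ 1, a : Fin N → ℝ with a i > 0 for all i, and T > 0. Suppose t is an allocation and there exists λ > 0 such that for every i: if t i > 0 then a i / (1 + a i * t i) = λ, and if t i = 0 then a i ≤ λ. Then for every allocation s, ∑_{i} log(1 + a i * s i) ≤ ∑_{i} log(1 + a i * t i). -/
/-- KKT sufficiency: if an allocation `t` admits a multiplier `λ > 0` with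
`a i / (1 + a i * t i) = λ` whenever `t i > 0` and `a i ≤ λ` whenever `t i = 0`,
then `t` maximizes `∑ log (1 + a i * s i)` over all allocations `s`. -/
theorem kkt_sufficient (N : ℕ) (hN : 1 ≤ N) (a : Fin N → ℝ)
    (ha : ∀ i, 0 < a i) (T : ℝ) (hT : 0 < T) (t : Fin N → ℝ)
    (ht0 : ∀ i, 0 ≤ t i) (htsum : ∑ i, t i = T)
    (hkkt : ∃ lam : ℝ, 0 < lam ∧ ∀ i,
      (0 < t i → a i / (1 + a i * t i) = lam) ∧ (t i = 0 → a i ≤ lam)) :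
    ∀ s : Fin N → ℝ, (∀ i, 0 ≤ s i) → ∑ i, s i = T →
      ∑ i, Real.log (1 + a i * s i) ≤ ∑ i, Real.log (1 + a i * t i) := by
  obtain ⟨lam, hlam, hk⟩ := hkkt
  intro s hs hsum
  have key : ∀ i, Real.log (1 + a i * s i) ≤
      Real.log (1 + a i * t i) + lam * (s i - t i) := by
    intro i
    have h1 : 0 < 1 + a i * s i := by
      have := mul_nonneg (ha i).le (hs i)
      linarith
    have h2 : 0 < 1 + a i * t i := by
      have := mul_nonneg (ha i).le (ht0 i)
      linarith
    have h3 := Real.log_le_sub_one_of_pos (div_pos h1 h2)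
    rw [Real.log_div h1.ne' h2.ne'] at h3
    have h4 : (1 + a i * s i) / (1 + a i * t i) - 1
        = a i / (1 + a i * t i) * (s i - t i) := by
      field_simp
      ring
    have h5 : a i / (1 + a i * t i) * (s i - t i) ≤ lam * (s i - t i) := by
      rcases (ht0 i).lt_or_eq with h | h
      · rw [(hk i).1 h]
      · have h6 := (hk i).2 h.symm
        rw [← h]
        simp only [mul_zero, add_zero, div_one, sub_zero]
        exact mul_le_mul_of_nonneg_right h6 (hs i)
    linarith
  have h := Finset.sum_le_sum (fun i (_ : i ∈ Finset.univ) => key i)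
  rw [Finset.sum_add_distrib, ← Finset.mul_sum, Finset.sum_sub_distrib, hsum, htsum] at h
  simpa using h
end

section
/- Let N ≥ 1, a : Fin N → ℝ with a i > 0 for all i, and T > 0. If the allocation t maximizes ∑_{i} log(1 + a i * s i) over all allocations s, then there exists λ > 0 such that for every i: if t i > 0 then a i / (1 + a i * t i) = λ, and if t i = 0 then a i ≤ λ. -/
theorem kkt_aux (N : ℕ) (a : Fin N → ℝ)
    (ha : ∀ i, 0 < a i) (T : ℝ) (t : Fin N → ℝ)
    (ht0 : ∀ i, 0 ≤ t i) (htsum : ∑ i, t i = T)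
    (hmax : ∀ s : Fin N → ℝ, (∀ i, 0 ≤ s i) → ∑ i, s i = T →
      ∑ i, Real.log (1 + a i * s i) ≤ ∑ i, Real.log (1 + a i * t i))
    (i j : Fin N) (hj : 0 < t j) :
    a i / (1 + a i * t i) ≤ a j / (1 + a j * t j) := by
  by_cases hij : i = j
  · rw [hij]
  have hai := ha i
  have haj := ha j
  have hX : 0 < 1 + a i * t i := by have := mul_nonneg hai.le (ht0 i); linarith
  have hY : 0 < 1 + a j * t j := by have := mul_nonneg haj.le (ht0 j); linarith
  rw [div_le_div_iff₀ hX hY]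
  by_contra! hlt
  have key : ∀ e : ℝ, 0 < e → e ≤ t j →
      (1 + a i * (t i + e)) * (1 + a j * (t j - e)) ≤ (1 + a i * t i) * (1 + a j * t j) := by
    intro e he hej
    have hXe : 0 < 1 + a i * (t i + e) := by
      have := mul_nonneg hai.le (add_nonneg (ht0 i) he.le); linarith
    have hYe : 0 < 1 + a j * (t j - e) := by
      have := mul_nonneg haj.le (sub_nonneg.2 hej); linarith
    let s : Fin N → ℝ := fun k => if k = i then t i + e else if k = j then t j - e else t k
    have hsi : s i = t i + e := by simp [s]
    have hsj : s j = t j - e := by simp [s, Ne.symm hij]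
    have hsk : ∀ k, k ≠ i → k ≠ j → s k = t k := by
      intro k h1 h2; simp [s, h1, h2]
    have h1 : ∑ k, (s k - t k) = (s i - t i) + (s j - t j) :=
      Finset.sum_eq_add i j hij (fun k _ hk => by rw [hsk k hk.1 hk.2, sub_self])
        (by simp) (by simp)
    have h2 : ∑ k, (Real.log (1 + a k * s k) - Real.log (1 + a k * t k)) =
        (Real.log (1 + a i * s i) - Real.log (1 + a i * t i)) +
        (Real.log (1 + a j * s j) - Real.log (1 + a j * t j)) :=
      Finset.sum_eq_add i j hij (fun k _ hk => by rw [hsk k hk.1 hk.2, sub_self])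
        (by simp) (by simp)
    rw [Finset.sum_sub_distrib, hsi, hsj] at h1 h2
    have h3 := hmax s (by
      intro k
      by_cases hk : k = i
      · rw [hk, hsi]; linarith [ht0 i]
      by_cases hk2 : k = j
      · rw [hk2, hsj]; linarith
      rw [hsk k hk hk2]; exact ht0 k) (by linarith)
    rw [← Real.log_le_log_iff (mul_pos hXe hYe) (mul_pos hX hY),
      Real.log_mul hXe.ne' hYe.ne', Real.log_mul hX.ne' hY.ne']
    linarith
  obtain ⟨D, hD⟩ : ∃ D, D = a i * (1 + a j * t j) - a j * (1 + a i * t i) := ⟨_, rfl⟩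
  have hD0 : 0 < D := by linarith
  have hP : 0 < a i * a j := mul_pos hai haj
  have he : 0 < min (t j) (D / (2 * (a i * a j))) := lt_min hj (by positivity)
  have hk := key _ he (min_le_left _ _)
  have hle := min_le_right (t j) (D / (2 * (a i * a j)))
  generalize min (t j) (D / (2 * (a i * a j))) = e at *
  rw [le_div_iff₀ (by positivity)] at hle
  have h5 : e * (D - a i * a j * e) ≤ 0 := by rw [hD]; linarith
  have h6 : 0 < e * (D - a i * a j * e) := mul_pos he (by linarith)
  linarith

/-- KKT necessity: if an allocation `t` maximizes `∑ log (1 + a i * s i)` over all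
allocations `s`, then there is a multiplier `λ > 0` with
`a i / (1 + a i * t i) = λ` whenever `t i > 0` and `a i ≤ λ` whenever `t i = 0`. -/
theorem kkt_necessary (N : ℕ) (hN : 1 ≤ N) (a : Fin N → ℝ)
    (ha : ∀ i, 0 < a i) (T : ℝ) (hT : 0 < T) (t : Fin N → ℝ)
    (ht0 : ∀ i, 0 ≤ t i) (htsum : ∑ i, t i = T)
    (hmax : ∀ s : Fin N → ℝ, (∀ i, 0 ≤ s i) → ∑ i, s i = T →
      ∑ i, Real.log (1 + a i * s i) ≤ ∑ i, Real.log (1 + a i * t i)) :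
    ∃ lam : ℝ, 0 < lam ∧ ∀ i,
      (0 < t i → a i / (1 + a i * t i) = lam) ∧ (t i = 0 → a i ≤ lam) := by
  obtain ⟨j, hj⟩ : ∃ j, 0 < t j := by
    by_contra! h
    have := Finset.sum_nonpos (fun i (_ : i ∈ Finset.univ) => h i)
    linarith
  have aux := kkt_aux N a ha T t ht0 htsum hmax
  refine ⟨a j / (1 + a j * t j), ?_, fun i => ⟨fun hi => ?_, fun hi => ?_⟩⟩
  · have := ha j
    positivity
  · exact le_antisymm (aux i j hj) (aux j i hi)
  · have := aux i j hj
    rwa [hi, mul_zero, add_zero, div_one] at this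
end

section
/- Let N ≥ 1, a : Fin N → ℝ with a i > 0 for all i, and T > 0. If the allocation t maximizes ∑_{i} log(1 + a i * s i) over all allocations s, then for all indices i, j: a i ≥ a j implies t i ≥ t j, and a i > a j together with t j > 0 implies t i > t j. -/
/-- Monotonicity of the optimal allocation in the aptitudes: at any maximizer `t`,
`a i ≥ a j` implies `t i ≥ t j`, and `a i > a j` with `t j > 0` implies `t i > t j`. -/
theorem optimal_monotone_in_aptitude (N : ℕ) (hN : 1 ≤ N) (a : Fin N → ℝ)
    (ha : ∀ i, 0 < a i) (T : ℝ) (hT : 0 < T) (t : Fin N → ℝ)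
    (ht0 : ∀ i, 0 ≤ t i) (htsum : ∑ i, t i = T)
    (hmax : ∀ s : Fin N → ℝ, (∀ i, 0 ≤ s i) → ∑ i, s i = T →
      ∑ i, Real.log (1 + a i * s i) ≤ ∑ i, Real.log (1 + a i * t i)) :
    ∀ i j, (a j ≤ a i → t j ≤ t i) ∧ (a j < a i → 0 < t j → t j < t i) := by
  have key : ∀ i j, i ≠ j → ∀ e, 0 < e → e ≤ t j →
      a i - a j + a i * a j * (t j - t i) ≤ a i * a j * e := by
    intro i j hij e he hej
    have split : ∀ g : Fin N → ℝ, ∑ k, g k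
        = g i + (g j + ∑ k ∈ (Finset.univ.erase i).erase j, g k) := by
      intro g
      rw [Finset.add_sum_erase _ g (by simp [hij.symm]),
        Finset.add_sum_erase _ g (Finset.mem_univ i)]
    let s : Fin N → ℝ := fun k => if k = i then t i + e else if k = j then t j - e else t k
    have si : s i = t i + e := by simp [s]
    have sj : s j = t j - e := by simp [s, hij.symm]
    have sk : ∀ k ∈ (Finset.univ.erase i).erase j, s k = t k := by
      intro k hk
      simp only [Finset.mem_erase] at hk
      simp [s, hk.1, hk.2.1]
    have h := hmax s (by
      intro k
      have h1 := ht0 k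
      have h2 := ht0 i
      simp only [s]
      split_ifs <;> linarith) (by
      rw [split s, si, sj, Finset.sum_congr rfl sk, ← htsum, split t]
      ring)
    rw [split, split (fun k => Real.log (1 + a k * t k)),
      Finset.sum_congr rfl (fun k hk => by rw [sk k hk] :
        ∀ k ∈ (Finset.univ.erase i).erase j,
          Real.log (1 + a k * s k) = Real.log (1 + a k * t k)), si, sj] at h
    have pi : 0 < 1 + a i * (t i + e) := by
      have := ha i
      have := ht0 i
      positivity
    have pj : 0 < 1 + a j * (t j - e) := by
      have := mul_nonneg (ha j).le (sub_nonneg.2 hej)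
      linarith
    have qi : 0 < 1 + a i * t i := by
      have := mul_nonneg (ha i).le (ht0 i)
      linarith
    have qj : 0 < 1 + a j * t j := by
      have := mul_nonneg (ha j).le (ht0 j)
      linarith
    have h' : Real.log ((1 + a i * (t i + e)) * (1 + a j * (t j - e)))
        ≤ Real.log ((1 + a i * t i) * (1 + a j * t j)) := by
      rw [Real.log_mul pi.ne' pj.ne', Real.log_mul qi.ne' qj.ne']
      linarith
    rw [Real.log_le_log_iff (mul_pos pi pj) (mul_pos qi qj)] at h'
    refine le_of_mul_le_mul_left ?_ he
    linarith
  intro i j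
  have hp : 0 < a i * a j := mul_pos (ha i) (ha j)
  constructor
  · intro hij
    by_contra hlt
    push Not at hlt
    have hne : i ≠ j := by
      rintro rfl
      exact lt_irrefl _ hlt
    have h := key i j hne ((t j - t i) / 2) (by linarith) (by linarith [ht0 i])
    have := mul_pos hp (sub_pos.2 hlt)
    linarith
  · intro hij htj
    by_contra hlt
    push Not at hlt
    have hne : i ≠ j := by
      rintro rfl
      exact lt_irrefl _ hij
    have hd : 0 < (a i - a j) / (2 * (a i * a j)) := div_pos (by linarith) (by linarith)
    have h := key i j hne (min (t j) ((a i - a j) / (2 * (a i * a j))))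
      (lt_min htj hd) (min_le_left _ _)
    have h2 := mul_le_mul_of_nonneg_left
      (min_le_right (t j) ((a i - a j) / (2 * (a i * a j)))) hp.le
    have h3 : a i * a j * ((a i - a j) / (2 * (a i * a j))) = (a i - a j) / 2 := by
      have := (ha i).ne'
      have := (ha j).ne'
      field_simp
    have := mul_nonneg hp.le (sub_nonneg.2 hlt)
    linarith
end

section
/- Let N ≥ 1, a : Fin N → ℝ with a i > 0 for all i, and T > 0. If the allocation t maximizes ∑_{i} log(1 + a i * s i) over all allocations s, then for all indices i, j with a i ≥ a j one has log(1 + a i * t i) ≥ log(1 + a j * t j); i.e., at the optimum the per-activity result is monotone in the aptitude. -/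
/-- At the optimum, the per-activity result `log (1 + a i * t i)` is monotone
in the aptitude: `a i ≥ a j` implies `log (1 + a i * t i) ≥ log (1 + a j * t j)`. -/
theorem optimal_result_monotone (N : ℕ) (hN : 1 ≤ N) (a : Fin N → ℝ)
    (ha : ∀ i, 0 < a i) (T : ℝ) (hT : 0 < T) (t : Fin N → ℝ)
    (ht0 : ∀ i, 0 ≤ t i) (htsum : ∑ i, t i = T)
    (hmax : ∀ s : Fin N → ℝ, (∀ i, 0 ≤ s i) → ∑ i, s i = T →
      ∑ i, Real.log (1 + a i * s i) ≤ ∑ i, Real.log (1 + a i * t i)) :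
    ∀ i j, a j ≤ a i → Real.log (1 + a j * t j) ≤ Real.log (1 + a i * t i) := by
  intro i j hij
  have hpos : ∀ k (x : ℝ), 0 ≤ x → 0 < 1 + a k * x := fun k x hx => by
    have := mul_nonneg (ha k).le hx
    linarith
  apply Real.log_le_log (hpos j _ (ht0 j))
  by_contra hcon
  have hlt : a i * t i < a j * t j := by linarith
  have htij : t i < t j := by
    by_contra h
    have h1 : a j * t j ≤ a i * t i :=
      mul_le_mul hij (not_lt.mp h) (ht0 j) (ha i).le
    linarith
  have hne : i ≠ j := by
    rintro rfl
    exact lt_irrefl _ htij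
  set m : ℝ := (t i + t j) / 2 with hm
  have hm0 : 0 ≤ m := by
    have := ht0 i
    have := ht0 j
    linarith
  let s : Fin N → ℝ := fun k => if k = i ∨ k = j then m else t k
  have hsi : s i = m := by simp [s]
  have hsj : s j = m := by simp [s]
  have key : ∀ g : Fin N → ℝ → ℝ,
      ∑ k, g k (s k) - ∑ k, g k (t k) = (g i m - g i (t i)) + (g j m - g j (t j)) := by
    intro g
    rw [← Finset.sum_sub_distrib, ← Finset.sum_subset (Finset.subset_univ {i, j}),
      Finset.sum_pair hne, hsi, hsj]
    intro k _ hk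
    have hk' : ¬ (k = i ∨ k = j) := by simpa using hk
    have : s k = t k := if_neg hk'
    rw [this, sub_self]
  have hs0 : ∀ k, 0 ≤ s k := by
    intro k
    by_cases hk : k = i ∨ k = j
    · have : s k = m := if_pos hk
      rwa [this]
    · have : s k = t k := if_neg hk
      rw [this]
      exact ht0 k
  have hsT : ∑ k, s k = T := by
    have := key (fun _ x => x)
    linarith
  have h1 := hmax s hs0 hsT
  have h2 := key (fun k x => Real.log (1 + a k * x))
  have h3 : Real.log ((1 + a i * t i) * (1 + a j * t j)) <
      Real.log ((1 + a i * m) * (1 + a j * m)) := by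
    apply Real.log_lt_log (mul_pos (hpos i _ (ht0 i)) (hpos j _ (ht0 j)))
    have e1 : 0 ≤ (a i - a j) * (t j - t i) :=
      mul_nonneg (by linarith) (by linarith)
    have e2 : 0 < a i * a j * (t j - t i) ^ 2 :=
      mul_pos (mul_pos (ha i) (ha j)) (pow_pos (by linarith) 2)
    have e3 : (1 + a i * m) * (1 + a j * m) - (1 + a i * t i) * (1 + a j * t j)
        = (a i - a j) * (t j - t i) / 2 + a i * a j * (t j - t i) ^ 2 / 4 := by
      rw [hm]
      ring
    linarith
  rw [Real.log_mul (hpos i _ (ht0 i)).ne' (hpos j _ (ht0 j)).ne',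
    Real.log_mul (hpos i _ hm0).ne' (hpos j _ hm0).ne'] at h3
  linarith
end

section
/- Let N ≥ 1, a : Fin N → ℝ with a i > 0 for all i, T > 0, and let λ > 0 satisfy ∑_{i} max(0, 1/λ − 1/(a i)) = T. Then the maximum of ∑_{i} log(1 + a i * s i) over all allocations s equals ∑_{i : a i > λ} log(a i / λ). -/
/-- Optimal value of the water-filling problem: with water level `λ` matching the
budget `T`, the maximum of `∑ log (1 + a i * s i)` over all allocations equals
`∑_{i : a i > λ} log (a i / λ)`. -/
theorem waterfilling_optimal_value (N : ℕ) (hN : 1 ≤ N) (a : Fin N → ℝ)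
    (ha : ∀ i, 0 < a i) (T : ℝ) (hT : 0 < T) (lam : ℝ) (hlam : 0 < lam)
    (hsum : ∑ i, max 0 (1 / lam - 1 / a i) = T) :
    IsGreatest
      ((fun s : Fin N → ℝ => ∑ i, Real.log (1 + a i * s i)) ''
        {s | (∀ i, 0 ≤ s i) ∧ ∑ i, s i = T})
      (∑ i ∈ Finset.univ.filter (fun i => lam < a i), Real.log (a i / lam)) := by
  have hpos : ∀ i, lam < a i → max 0 (1 / lam - 1 / a i) = 1 / lam - 1 / a i := by
    intro i h
    apply max_eq_right
    have := one_div_le_one_div_of_le hlam h.le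
    linarith
  have hneg : ∀ i, ¬ lam < a i → max 0 (1 / lam - 1 / a i) = 0 := by
    intro i h
    apply max_eq_left
    have := one_div_le_one_div_of_le (ha i) (not_lt.mp h)
    linarith
  rw [Finset.sum_filter]
  constructor
  · refine ⟨fun i => max 0 (1 / lam - 1 / a i), ⟨fun i => le_max_left _ _, hsum⟩, ?_⟩
    apply Finset.sum_congr rfl
    intro i _
    have hai := ha i
    by_cases h : lam < a i
    · simp only [hpos i h, if_pos h]
      congr 1
      field_simp
      ring
    · simp only [hneg i h, if_neg h]
      simp
  · rintro _ ⟨s, ⟨hs, hsT⟩, rfl⟩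
    have key : ∀ i, Real.log (1 + a i * s i) ≤ (if lam < a i then Real.log (a i / lam) else 0)
        + lam * (s i - max 0 (1 / lam - 1 / a i)) := by
      intro i
      have hai := ha i
      have hsi := hs i
      have h1 : 0 < 1 + a i * s i := by positivity
      by_cases h : lam < a i
      · rw [hpos i h, if_pos h]
        have h2 : 0 < a i / lam := by positivity
        have h3 := Real.log_le_sub_one_of_pos (div_pos h1 h2)
        rw [Real.log_div h1.ne' h2.ne'] at h3
        have h4 : (1 + a i * s i) / (a i / lam) - 1 = lam * (s i - (1 / lam - 1 / a i)) := by
          field_simp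
          ring
        linarith
      · rw [hneg i h, if_neg h]
        have h3 := Real.log_le_sub_one_of_pos h1
        have h4 := mul_le_mul_of_nonneg_right (not_lt.mp h) hsi
        linarith
    have hle := Finset.sum_le_sum (fun i (_ : i ∈ Finset.univ) => key i)
    rw [Finset.sum_add_distrib, ← Finset.mul_sum, Finset.sum_sub_distrib, hsT, hsum] at hle
    simpa using hle
end

section
/- Let N ≥ 2, a : Fin N → ℝ with a i > 0 for all i, and let i₀ be such that a i₀ > a i for all i ≠ i₀. If 0 < T ≤ min over i ≠ i₀ of (1/(a i) − 1/(a i₀)), then the allocation assigning T to activity i₀ and 0 to every other activity maximizes ∑_{i} log(1 + a i * s i) over all allocations s. -/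
/-- Small budget: if activity `i₀` has the strictly best aptitude and
`0 < T ≤ 1/(a i) - 1/(a i₀)` for every `i ≠ i₀`, then devoting all the time `T`
to `i₀` maximizes `∑ log (1 + a i * s i)` over all allocations. -/
theorem small_time_all_to_best (N : ℕ) (hN : 2 ≤ N) (a : Fin N → ℝ)
    (ha : ∀ i, 0 < a i) (i₀ : Fin N) (hbest : ∀ i, i ≠ i₀ → a i < a i₀)
    (T : ℝ) (hT : 0 < T) (hTle : ∀ i, i ≠ i₀ → T ≤ 1 / a i - 1 / a i₀) :
    ∀ s : Fin N → ℝ, (∀ i, 0 ≤ s i) → ∑ i, s i = T →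
      ∑ i, Real.log (1 + a i * s i) ≤
        ∑ i, Real.log (1 + a i * (if i = i₀ then T else 0)) := by
  intro s hs hsum
  have h0 := ha i₀
  have hpos : 0 < 1 + a i₀ * T := by positivity
  have key : ∀ i, Real.log (1 + a i * s i) ≤
      Real.log (1 + a i * (if i = i₀ then T else 0)) +
        a i₀ / (1 + a i₀ * T) * (s i - (if i = i₀ then T else 0)) := by
    intro i
    have hai := ha i
    have hsi := hs i
    have hp : 0 < 1 + a i * s i := by positivity
    by_cases h : i = i₀
    · subst h
      simp only [if_true]
      have h1 := Real.log_le_sub_one_of_pos (div_pos hp hpos)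
      rw [Real.log_div hp.ne' hpos.ne'] at h1
      have h2 : (1 + a i * s i) / (1 + a i * T) - 1 = a i / (1 + a i * T) * (s i - T) := by
        field_simp
        ring
      linarith
    · simp only [if_neg h, mul_zero, add_zero, Real.log_one, zero_add, sub_zero]
      have h1 := Real.log_le_sub_one_of_pos hp
      have h2 : a i ≤ a i₀ / (1 + a i₀ * T) := by
        rw [le_div_iff₀ hpos]
        have h3 := mul_le_mul_of_nonneg_left (hTle i h) (mul_pos hai h0).le
        have h4 : a i * a i₀ * (1 / a i - 1 / a i₀) = a i₀ - a i := by
          field_simp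
        linarith
      have h5 := mul_le_mul_of_nonneg_right h2 hsi
      linarith
  have hfin := Finset.sum_le_sum (fun i (_ : i ∈ Finset.univ) => key i)
  rw [Finset.sum_add_distrib, ← Finset.mul_sum, Finset.sum_sub_distrib, hsum] at hfin
  simpa using hfin
end

section
/- Let N ≥ 1, a : Fin N → ℝ with a i > 0 for all i, let m = min_i a i, and suppose T > ∑_{i} (1/m − 1/(a i)). If the allocation t maximizes ∑_{i} log(1 + a i * s i) over all allocations s, then t i > 0 for every i. -/
/-- Large budget: let `m = min_i a i`. If `T > ∑ i (1/m - 1/(a i))`, then any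
maximizer `t` of `∑ log (1 + a i * s i)` assigns positive time to every activity. -/
theorem large_time_all_positive (N : ℕ) (hN : 1 ≤ N) (a : Fin N → ℝ)
    (ha : ∀ i, 0 < a i) (m : ℝ)
    (hm : m = Finset.univ.inf' ⟨⟨0, hN⟩, Finset.mem_univ _⟩ a)
    (T : ℝ) (hT : ∑ i, (1 / m - 1 / a i) < T) (t : Fin N → ℝ)
    (ht0 : ∀ i, 0 ≤ t i) (htsum : ∑ i, t i = T)
    (hmax : ∀ s : Fin N → ℝ, (∀ i, 0 ≤ s i) → ∑ i, s i = T →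
      ∑ i, Real.log (1 + a i * s i) ≤ ∑ i, Real.log (1 + a i * t i)) :
    ∀ i, 0 < t i := by
  by_contra! hcon
  obtain ⟨k, hk⟩ := hcon
  have hk0 : t k = 0 := le_antisymm hk (ht0 k)
  have hma : ∀ i, m ≤ a i := fun i => by
    rw [hm]; exact Finset.inf'_le _ (Finset.mem_univ i)
  have hm0 : 0 < m := by
    rw [hm]; exact (Finset.lt_inf'_iff _).2 (fun i _ => ha i)
  have hinv : ∀ i, 1 / a i ≤ 1 / m := fun i => one_div_le_one_div_of_le hm0 (hma i)
  rw [← htsum] at hT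
  obtain ⟨j, -, hj⟩ := Finset.exists_lt_of_sum_lt hT
  have hjk : k ≠ j := by
    rintro rfl
    have := hinv k
    linarith
  have htj : 0 < t j := by
    have := hinv j
    linarith
  have hD : 0 < t j + 1 / a j - 1 / a k := by
    have := hinv k
    linarith
  have haj := ha j
  have hak := ha k
  obtain ⟨e, he0, hetj, heD⟩ : ∃ e : ℝ, 0 < e ∧ e ≤ t j ∧ e < t j + 1 / a j - 1 / a k := by
    refine ⟨min (t j) ((t j + 1 / a j - 1 / a k) / 2), lt_min htj (by linarith),
      min_le_left _ _, lt_of_le_of_lt (min_le_right _ _) (by linarith)⟩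
  have hkey : 1 + a j * t j < (1 + a k * e) * (1 + a j * (t j - e)) := by
    have h1 : 0 < a k * a j * e * (t j + 1 / a j - 1 / a k - e) := by
      have : 0 < t j + 1 / a j - 1 / a k - e := by linarith
      positivity
    have h2 : a k * a j * e * (t j + 1 / a j - 1 / a k - e)
        = (1 + a k * e) * (1 + a j * (t j - e)) - (1 + a j * t j) := by
      field_simp
      ring
    linarith
  let s : Fin N → ℝ := fun i => t i + (if i = k then e else 0) - (if i = j then e else 0)
  have hsk : s k = e := by simp [s, hk0, hjk]
  have hsj : s j = t j - e := by simp [s, hjk.symm]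
  have hso : ∀ i, i ≠ k ∧ i ≠ j → s i = t i := fun i hi => by simp [s, hi.1, hi.2]
  have hs0 : ∀ i, 0 ≤ s i := by
    intro i
    by_cases h1 : i = k
    · rw [h1, hsk]; exact he0.le
    by_cases h2 : i = j
    · rw [h2, hsj]; linarith
    rw [hso i ⟨h1, h2⟩]; exact ht0 i
  have hss : ∑ i, s i = T := by
    simp [s, Finset.sum_add_distrib, Finset.sum_sub_distrib, htsum]
  have hle := hmax s hs0 hss
  have hdiff : ∑ i, (Real.log (1 + a i * s i) - Real.log (1 + a i * t i))
      = (Real.log (1 + a k * s k) - Real.log (1 + a k * t k))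
        + (Real.log (1 + a j * s j) - Real.log (1 + a j * t j)) :=
    Fintype.sum_eq_add k j hjk (fun i hi => by rw [hso i hi, sub_self])
  rw [Finset.sum_sub_distrib, hsk, hsj, hk0] at hdiff
  have hp : 0 < 1 + a j * (t j - e) := by
    have := mul_nonneg haj.le (sub_nonneg.2 hetj)
    linarith
  have hlog := Real.log_lt_log (by positivity) hkey
  rw [Real.log_mul (by positivity) hp.ne'] at hlog
  simp only [mul_zero, add_zero, Real.log_one] at hdiff
  linarith
end

section
/- Let N ≥ 1, a : Fin N → ℝ with a i > 0 for all i, T > 0, let λ > 0 satisfy ∑_{i} max(0, 1/λ − 1/(a i)) = T, and set t i = max(0, 1/λ − 1/(a i)). Then for every allocation s: ∑_{i} log(1 + a i * s i) ≤ ∑_{i} log(1 + a i * t i) + ∑_{i} (a i / (1 + a i * t i)) * (s i − t i), and moreover ∑_{i} (a i / (1 + a i * t i)) * (s i − t i) ≤ λ * ∑_{i} (s i − t i) = 0. -/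
/-- Gradient (first-order concavity) inequality for water-filling: for the
water-filling allocation `t i = max 0 (1/λ - 1/(a i))` and any allocation `s`,
`∑ log (1 + a i * s i) ≤ ∑ log (1 + a i * t i) + ∑ (a i / (1 + a i * t i)) * (s i - t i)`,
and the correction term is at most `λ * ∑ (s i - t i) = 0`. -/
theorem waterfilling_gradient_inequality (N : ℕ) (hN : 1 ≤ N) (a : Fin N → ℝ)
    (ha : ∀ i, 0 < a i) (T : ℝ) (hT : 0 < T) (lam : ℝ) (hlam : 0 < lam)
    (hsum : ∑ i, max 0 (1 / lam - 1 / a i) = T) (t : Fin N → ℝ)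
    (ht : ∀ i, t i = max 0 (1 / lam - 1 / a i)) :
    ∀ s : Fin N → ℝ, (∀ i, 0 ≤ s i) → ∑ i, s i = T →
      (∑ i, Real.log (1 + a i * s i) ≤
        ∑ i, Real.log (1 + a i * t i) +
          ∑ i, (a i / (1 + a i * t i)) * (s i - t i)) ∧
      (∑ i, (a i / (1 + a i * t i)) * (s i - t i) ≤ lam * ∑ i, (s i - t i)) ∧
      lam * ∑ i, (s i - t i) = 0 := by
  intro s hs hsT
  have htn : ∀ i, 0 ≤ t i := fun i => by rw [ht i]; exact le_max_left _ _
  have hp : ∀ i, 0 < 1 + a i * t i := fun i => by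
    have := mul_nonneg (ha i).le (htn i)
    linarith
  have hq : ∀ i, 0 < 1 + a i * s i := fun i => by
    have := mul_nonneg (ha i).le (hs i)
    linarith
  refine ⟨?_, ?_, ?_⟩
  · rw [← Finset.sum_add_distrib]
    refine Finset.sum_le_sum fun i _ => ?_
    have h := Real.log_le_sub_one_of_pos (div_pos (hq i) (hp i))
    rw [Real.log_div (hq i).ne' (hp i).ne'] at h
    have e : (1 + a i * s i) / (1 + a i * t i) - 1
        = (a i / (1 + a i * t i)) * (s i - t i) := by
      have := (hp i).ne'
      field_simp
      ring
    linarith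
  · rw [Finset.mul_sum]
    refine Finset.sum_le_sum fun i _ => ?_
    have hai := ha i
    rcases le_total (1 / lam - 1 / a i) 0 with h | h
    · have h0 : t i = 0 := by rw [ht i, max_eq_left h]
      have hl : a i ≤ lam := (one_div_le_one_div hlam hai).1 (by linarith)
      rw [h0]
      simpa using mul_le_mul_of_nonneg_right hl (hs i)
    · have h0 : t i = 1 / lam - 1 / a i := by rw [ht i, max_eq_right h]
      have e : 1 + a i * t i = a i / lam := by
        rw [h0]
        field_simp
        ring
      have e2 : a i / (1 + a i * t i) = lam := by
        rw [e]
        field_simp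
      rw [e2]
  · have : ∑ i, t i = T := by rw [← hsum]; exact Finset.sum_congr rfl fun i _ => ht i
    rw [Finset.sum_sub_distrib, hsT, this, sub_self, mul_zero]
end
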